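/- Let r ∈ {−1, 1}, α ∈ (0,1), f ∈ OM_+^1, and Φ = Φ_{(r,α)}. Then the following are equivalent: (I) f preserves σ_Φ; (II) f = Φ_{(r,β)} for some β ∈ [0,1]. -/

import Mathlib

open Matrix Filter Set Topology
open scoped ComplexOrder

noncomputable def matFun {n : ℕ} (f : ℝ → ℝ) (A : Matrix (Fin n) (Fin n) ℂ) :
    Matrix (Fin n) (Fin n) ℂ := cfc f A

def loewnerLE {n : ℕ} (A B : Matrix (Fin n) (Fin n) ℂ) : Prop := (B - A).PosSemidef

def OpMonotone (f : ℝ → ℝ) : Prop :=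
  ∀ (n : ℕ) (A B : Matrix (Fin n) (Fin n) ℂ), A.PosDef → B.PosDef →
    loewnerLE A B → loewnerLE (matFun f A) (matFun f B)

def OMone (f : ℝ → ℝ) : Prop :=
  (∀ t : ℝ, 0 < t → 0 < f t) ∧ f 1 = 1 ∧ OpMonotone f

noncomputable def kuboMean {n : ℕ} (Φ : ℝ → ℝ) (A B : Matrix (Fin n) (Fin n) ℂ) :
    Matrix (Fin n) (Fin n) ℂ :=
  matFun Real.sqrt A *
    matFun Φ (matFun (fun x => (Real.sqrt x)⁻¹) A * B * matFun (fun x => (Real.sqrt x)⁻¹) A) *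
    matFun Real.sqrt A

def Subpreserves (Φ f : ℝ → ℝ) : Prop :=
  ∀ (n : ℕ) (A B : Matrix (Fin n) (Fin n) ℂ), A.PosDef → B.PosDef →
    loewnerLE (matFun f (kuboMean Φ A B)) (kuboMean Φ (matFun f A) (matFun f B))

def PreservesMean (Φ f : ℝ → ℝ) : Prop :=
  ∀ (n : ℕ) (A B : Matrix (Fin n) (Fin n) ℂ), A.PosDef → B.PosDef →
    matFun f (kuboMean Φ A B) = kuboMean Φ (matFun f A) (matFun f B)

def OMTrivial (f : ℝ → ℝ) : Prop :=
  (∀ t : ℝ, 0 < t → f t = 1) ∨ (∀ t : ℝ, 0 < t → f t = t)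

noncomputable def adjFun (f : ℝ → ℝ) : ℝ → ℝ := fun t => (f t⁻¹)⁻¹

noncomputable def transFun (f : ℝ → ℝ) : ℝ → ℝ := fun t => t * f t⁻¹


noncomputable def powerRep (r a : ℝ) : ℝ → ℝ :=
  fun t => if r = 0 then t ^ a else (a * t ^ r + (1 - a)) ^ (1 / r)

section Affine

variable {h : ℝ → ℝ} {α : ℝ}

/-- A monotone function on `(0, ∞)` which respects one proper convex combination satisfies the
affine interpolation identity. -/
lemma interpolation_of_monotoneOn_of_combination (hα : α ∈ Ioo (0 : ℝ) 1)
    (hmono : MonotoneOn h (Ioi 0))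
    (haff : ∀ x y, 0 < x → 0 < y → h ((1 - α) * x + α * y) = (1 - α) * h x + α * h y)
    {a b t : ℝ} (ha : 0 < a) (hab : a < b) (ht : t ∈ Icc a b) :
    (b - a) * (h t - h a) = (t - a) * (h b - h a) := by
  obtain ⟨h0, h1⟩ := hα
  set g : ℝ → ℝ := fun s => (b - a) * (h s - h a) - (s - a) * (h b - h a) with hg
  have hcomb : ∀ x y, 0 < x → 0 < y → g ((1 - α) * x + α * y) = (1 - α) * g x + α * g y := by
    intro x y hx hy
    simp only [hg, haff x y hx hy]
    ring
  have hga : g a = 0 := by simp [hg]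
  have hgb : g b = 0 := by simp [hg]
  set c := max α (1 - α) with hc
  have hc0 : 0 ≤ c := h0.le.trans (le_max_left _ _)
  have hc1 : c < 1 := max_lt h1 (by linarith)
  set K := (b - a) * (h b - h a) with hK
  have hbd : ∀ n : ℕ, ∀ s ∈ Icc a b, |g s| ≤ c ^ n * K := by
    intro n
    induction n with
    | zero =>
      rintro s ⟨hs1, hs2⟩
      have e1 : h a ≤ h s := hmono ha (ha.trans_le hs1) hs1
      have e2 : h s ≤ h b := hmono (ha.trans_le hs1) (ha.trans hab) hs2
      simp only [hg, hK, pow_zero, one_mul]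
      rw [abs_le]
      constructor <;> nlinarith
    | succ n ih =>
      rintro s ⟨hs1, hs2⟩
      rcases le_total s ((1 - α) * a + α * b) with hs | hs
      · have hy : a + (s - a) / α ∈ Icc a b := by
          refine ⟨le_add_of_nonneg_right (div_nonneg (by linarith) h0.le), ?_⟩
          have : (s - a) / α ≤ b - a := by rw [div_le_iff₀ h0]; linarith
          linarith
        have e := hcomb a _ ha (ha.trans_le hy.1)
        have es : (1 - α) * a + α * (a + (s - a) / α) = s := by field_simp; ring
        rw [es, hga, mul_zero, zero_add] at e
        rw [e, abs_mul, abs_of_pos h0, pow_succ', mul_assoc]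
        exact mul_le_mul (le_max_left _ _) (ih _ hy) (abs_nonneg _) hc0
      · have h1' : 0 < 1 - α := by linarith
        have hy : b - (b - s) / (1 - α) ∈ Icc a b := by
          refine ⟨?_, sub_le_self _ (div_nonneg (by linarith) h1'.le)⟩
          have : (b - s) / (1 - α) ≤ b - a := by rw [div_le_iff₀ h1']; linarith
          linarith
        have e := hcomb _ b (ha.trans_le hy.1) (ha.trans hab)
        have es : (1 - α) * (b - (b - s) / (1 - α)) + α * b = s := by field_simp; ring
        rw [es, hgb, mul_zero, add_zero] at e
        rw [e, abs_mul, abs_of_pos h1', pow_succ', mul_assoc]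
        exact mul_le_mul (le_max_right _ _) (ih _ hy) (abs_nonneg _) hc0
  have hlim : Tendsto (fun n : ℕ => c ^ n * K) atTop (𝓝 0) := by
    simpa using (tendsto_pow_atTop_nhds_zero_of_lt_one hc0 hc1).mul_const K
  have hzero : g t = 0 :=
    abs_nonpos_iff.mp (ge_of_tendsto' hlim fun n => hbd n t ht)
  exact sub_eq_zero.mp hzero

lemma eq_affine_of_monotoneOn_of_combination (hα : α ∈ Ioo (0 : ℝ) 1)
    (hpos : ∀ t, 0 < t → 0 < h t) (hone : h 1 = 1) (hmono : MonotoneOn h (Ioi 0))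
    (haff : ∀ x y, 0 < x → 0 < y → h ((1 - α) * x + α * y) = (1 - α) * h x + α * h y) :
    ∃ β ∈ Icc (0 : ℝ) 1, ∀ t, 0 < t → h t = β * t + (1 - β) := by
  have hint := @interpolation_of_monotoneOn_of_combination h α hα hmono haff
  have key : ∀ t, 0 < t → h t = (h 2 - 1) * t + (1 - (h 2 - 1)) := by
    intro t ht
    rcases le_or_gt t 1 with h1 | h1
    · have e := @hint t 2 1 ht (by linarith) ⟨h1, by norm_num⟩
      rw [hone] at e
      linarith
    · rcases le_or_gt t 2 with h2 | h2
      · have e := @hint 1 2 t one_pos (by norm_num) ⟨h1.le, h2⟩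
        rw [hone] at e
        linarith
      · have e := @hint 1 t 2 one_pos h1 ⟨by norm_num, h2.le⟩
        rw [hone] at e
        linarith
  refine ⟨h 2 - 1, ⟨?_, ?_⟩, key⟩
  · have := hmono (mem_Ioi.mpr one_pos) (mem_Ioi.mpr two_pos) one_le_two
    linarith
  · by_contra! hβ
    set β := h 2 - 1
    have hβ0 : 0 < β := by linarith
    have ht : 0 < (β - 1) / β := div_pos (by linarith) hβ0
    have e := key _ ht
    have := hpos _ ht
    rw [mul_div_cancel₀ _ hβ0.ne'] at e
    linarith

end Affine

section Scalar

lemma posDef_algebraMap {n : ℕ} {x : ℝ} (hx : 0 < x) :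
    (algebraMap ℝ (Matrix (Fin n) (Fin n) ℂ) x).PosDef := by
  rw [Algebra.algebraMap_eq_smul_one]
  exact Matrix.PosDef.one.smul hx

lemma matFun_algebraMap {n : ℕ} (f : ℝ → ℝ) (x : ℝ) :
    matFun f (algebraMap ℝ (Matrix (Fin n) (Fin n) ℂ) x) = algebraMap ℝ _ (f x) :=
  cfc_algebraMap x f

lemma kuboMean_algebraMap {n : ℕ} (Φ : ℝ → ℝ) (x y : ℝ) :
    kuboMean Φ (algebraMap ℝ (Matrix (Fin n) (Fin n) ℂ) x) (algebraMap ℝ _ y) =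
      algebraMap ℝ _ (√x * Φ ((√x)⁻¹ * y * (√x)⁻¹) * √x) := by
  simp only [kuboMean, matFun_algebraMap, ← map_mul]

lemma PreservesMean.scalar {Φ f : ℝ → ℝ} (hf : PreservesMean Φ f) {x y : ℝ} (hx : 0 < x)
    (hy : 0 < y) :
    f (√x * Φ ((√x)⁻¹ * y * (√x)⁻¹) * √x) =
      √(f x) * Φ ((√(f x))⁻¹ * f y * (√(f x))⁻¹) * √(f x) := by
  have e := hf 1 _ _ (posDef_algebraMap hx) (posDef_algebraMap hy)
  simp only [kuboMean_algebraMap, matFun_algebraMap] at e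
  exact (algebraMap ℝ (Matrix (Fin 1) (Fin 1) ℂ)).injective e

lemma OpMonotone.monotoneOn {f : ℝ → ℝ} (hf : OpMonotone f) : MonotoneOn f (Ioi 0) := by
  intro x hx y hy hxy
  have key : ∀ u v : ℝ, loewnerLE (algebraMap ℝ (Matrix (Fin 1) (Fin 1) ℂ) u)
      (algebraMap ℝ _ v) ↔ u ≤ v := by
    intro u v
    rw [loewnerLE, ← map_sub, ← sub_nonneg (a := v)]
    constructor
    · intro h
      simpa [Matrix.algebraMap_matrix_apply] using h.diag_nonneg (i := 0)
    · intro h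
      rw [Algebra.algebraMap_eq_smul_one]
      exact Matrix.PosSemidef.one.smul h
  have := hf 1 _ _ (posDef_algebraMap hx) (posDef_algebraMap hy) ((key x y).mpr hxy)
  rwa [matFun_algebraMap, matFun_algebraMap, key] at this

lemma powerRep_one (a t : ℝ) : powerRep 1 a t = a * t + (1 - a) := by
  simp [powerRep]

lemma powerRep_neg_one (a t : ℝ) : powerRep (-1) a t = (a * t⁻¹ + (1 - a))⁻¹ := by
  simp [powerRep, Real.rpow_neg_one]

lemma scalar_mean_powerRep_one (α : ℝ) {x : ℝ} (y : ℝ) (hx : 0 < x) :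
    √x * powerRep 1 α ((√x)⁻¹ * y * (√x)⁻¹) * √x = (1 - α) * x + α * y := by
  have hs : √x ≠ 0 := (Real.sqrt_pos.mpr hx).ne'
  have hss : √x ^ 2 = x := Real.sq_sqrt hx.le
  rw [powerRep_one]
  field_simp
  rw [hss]
  ring

lemma scalar_mean_powerRep_neg_one (α : ℝ) {x : ℝ} (y : ℝ) (hx : 0 < x) :
    √x * powerRep (-1) α ((√x)⁻¹ * y * (√x)⁻¹) * √x = ((1 - α) * x⁻¹ + α * y⁻¹)⁻¹ := by
  have hs : √x ≠ 0 := (Real.sqrt_pos.mpr hx).ne'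
  have hss : x = √x * √x := (Real.mul_self_sqrt hx.le).symm
  have e : (1 - α) * x⁻¹ + α * y⁻¹ =
      (√x)⁻¹ * (α * ((√x)⁻¹ * y * (√x)⁻¹)⁻¹ + (1 - α)) * (√x)⁻¹ := by
    conv_lhs => rw [hss]
    simp only [mul_inv, inv_inv]
    field_simp
    ring
  rw [powerRep_neg_one, e]
  simp only [mul_inv, inv_inv]

end Scalar

section Matrices

variable {n : ℕ} {A B : Matrix (Fin n) (Fin n) ℂ}

lemma continuousOn_real_spectrum (f : ℝ → ℝ) (A : Matrix (Fin n) (Fin n) ℂ) :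
    ContinuousOn f (spectrum ℝ A) :=
  A.finite_real_spectrum.continuousOn f

lemma Matrix.PosDef.pos_of_mem_spectrum (hA : A.PosDef) {t : ℝ} (ht : t ∈ spectrum ℝ A) :
    0 < t := by
  rw [hA.1.spectrum_real_eq_range_eigenvalues] at ht
  obtain ⟨i, rfl⟩ := ht
  exact hA.eigenvalues_pos i

lemma matFun_congr (hA : A.PosDef) {f g : ℝ → ℝ} (h : ∀ t, 0 < t → f t = g t) :
    matFun f A = matFun g A :=
  cfc_congr fun _ ht => h _ (hA.pos_of_mem_spectrum ht)

lemma matFun_mul (f g : ℝ → ℝ) (A : Matrix (Fin n) (Fin n) ℂ) :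
    matFun f A * matFun g A = matFun (fun t => f t * g t) A :=
  (cfc_mul f g A (continuousOn_real_spectrum _ _) (continuousOn_real_spectrum _ _)).symm

lemma matFun_id (hA : A.PosDef) : matFun (fun t => t) A = A :=
  cfc_id' ℝ A hA.1

lemma matFun_one (hA : A.PosDef) : matFun (fun _ => 1) A = 1 :=
  cfc_const_one ℝ A hA.1

lemma matFun_affine (hA : A.PosDef) (f : ℝ → ℝ) (a b : ℝ) :
    matFun (fun t => a * f t + b) A = a • matFun f A + b • 1 := by
  unfold matFun
  rw [cfc_add (R := ℝ) A (fun t => a * f t) (fun _ => b) (continuousOn_real_spectrum _ _)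
    (continuousOn_real_spectrum _ _), cfc_const_mul a f A (continuousOn_real_spectrum _ _),
    ← Algebra.algebraMap_eq_smul_one]
  exact congrArg _ (cfc_const b A hA.1)

lemma matFun_mul_matFun_inv (hA : A.PosDef) {f : ℝ → ℝ} (hf : ∀ t, 0 < t → 0 < f t) :
    matFun f A * matFun (fun t => (f t)⁻¹) A = 1 := by
  rw [matFun_mul, ← matFun_one hA]
  exact matFun_congr hA fun t ht => mul_inv_cancel₀ (hf t ht).ne'

lemma matFun_inv_apply (hA : A.PosDef) {f : ℝ → ℝ} (hf : ∀ t, 0 < t → 0 < f t) :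
    matFun (fun t => (f t)⁻¹) A = (matFun f A)⁻¹ :=
  (Matrix.inv_eq_right_inv (matFun_mul_matFun_inv hA hf)).symm

lemma matFun_inv (hA : A.PosDef) : matFun (fun t => t⁻¹) A = A⁻¹ := by
  rw [matFun_inv_apply hA fun _ ht => ht, matFun_id hA]

lemma isHermitian_matFun (f : ℝ → ℝ) (A : Matrix (Fin n) (Fin n) ℂ) :
    (matFun f A).IsHermitian :=
  cfc_predicate f A

lemma combination_pos {a t : ℝ} (ha : a ∈ Icc (0 : ℝ) 1) (ht : 0 < t) :
    0 < a * t + (1 - a) := by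
  rcases ha.1.eq_or_lt with h | h
  · simp [← h]
  · have := mul_pos h ht
    linarith [ha.2]

lemma Matrix.PosDef.combination (hA : A.PosDef) (hB : B.PosDef) {a : ℝ}
    (ha : a ∈ Icc (0 : ℝ) 1) : (a • A + (1 - a) • B).PosDef := by
  rcases ha.1.eq_or_lt with h | h
  · simpa [← h] using hB
  · exact (hA.smul h).add_posSemidef (hB.posSemidef.smul (sub_nonneg.mpr ha.2))

lemma matFun_powerRep_one (hA : A.PosDef) (a : ℝ) :
    matFun (powerRep 1 a) A = a • A + (1 - a) • 1 := by
  rw [funext (powerRep_one a), matFun_affine hA (fun t => t), matFun_id hA]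

lemma matFun_powerRep_neg_one (hA : A.PosDef) {a : ℝ} (ha : a ∈ Icc (0 : ℝ) 1) :
    matFun (powerRep (-1) a) A = (a • A⁻¹ + (1 - a) • 1)⁻¹ := by
  rw [funext (powerRep_neg_one a),
    matFun_inv_apply hA fun t ht => combination_pos ha (inv_pos.mpr ht),
    matFun_affine hA (fun t => t⁻¹), matFun_inv hA]

lemma matFun_sqrt_mul_self (hA : A.PosDef) : matFun Real.sqrt A * matFun Real.sqrt A = A := by
  rw [matFun_mul]
  exact (matFun_congr hA fun t ht => Real.mul_self_sqrt ht.le).trans (matFun_id hA)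

lemma matFun_sqrt_mul_inv_sqrt (hA : A.PosDef) :
    matFun Real.sqrt A * matFun (fun x => (√x)⁻¹) A = 1 :=
  matFun_mul_matFun_inv hA fun _ => Real.sqrt_pos.mpr

lemma posDef_inv_sqrt_conj (hA : A.PosDef) (hB : B.PosDef) :
    (matFun (fun x => (√x)⁻¹) A * B * matFun (fun x => (√x)⁻¹) A).PosDef := by
  have hT := isHermitian_matFun (fun x => (√x)⁻¹) A
  have hinj : Function.Injective (matFun (fun x => (√x)⁻¹) A).mulVec :=
    Matrix.mulVec_injective_of_isUnit
      (IsUnit.of_mul_eq_one_right _ (matFun_sqrt_mul_inv_sqrt hA))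
  simpa only [hT.eq] using hB.conjTranspose_mul_mul_same hinj

lemma kuboMean_powerRep_one (hA : A.PosDef) (hB : B.PosDef) (a : ℝ) :
    kuboMean (powerRep 1 a) A B = a • B + (1 - a) • A := by
  rw [kuboMean, matFun_powerRep_one (posDef_inv_sqrt_conj hA hB)]
  have hST := matFun_sqrt_mul_inv_sqrt hA
  have hTS := mul_eq_one_comm.mp hST
  have hSS := matFun_sqrt_mul_self hA
  set S := matFun Real.sqrt A
  set T := matFun (fun x => (√x)⁻¹) A
  have e : S * (T * B * T) * S = B := by
    calc S * (T * B * T) * S = (S * T) * B * (T * S) := by noncomm_ring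
      _ = B := by rw [hST, hTS, one_mul, mul_one]
  rw [mul_add, add_mul, mul_smul_comm, smul_mul_assoc, e, mul_smul_comm, smul_mul_assoc, mul_one,
    hSS]

lemma kuboMean_powerRep_neg_one (hA : A.PosDef) (hB : B.PosDef) {a : ℝ}
    (ha : a ∈ Icc (0 : ℝ) 1) :
    kuboMean (powerRep (-1) a) A B = (a • B⁻¹ + (1 - a) • A⁻¹)⁻¹ := by
  rw [kuboMean, matFun_powerRep_neg_one (posDef_inv_sqrt_conj hA hB) ha]
  have hST := matFun_sqrt_mul_inv_sqrt hA
  have hTS := mul_eq_one_comm.mp hST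
  have hSS := matFun_sqrt_mul_self hA
  set S := matFun Real.sqrt A
  set T := matFun (fun x => (√x)⁻¹) A
  have hSi : S⁻¹ = T := Matrix.inv_eq_right_inv hST
  have hTi : T⁻¹ = S := Matrix.inv_eq_right_inv hTS
  have hTT : T * T = A⁻¹ := by rw [← hSS, Matrix.mul_inv_rev, hSi]
  have e : T * (S * B⁻¹ * S) * T = B⁻¹ := by
    calc T * (S * B⁻¹ * S) * T = (T * S) * B⁻¹ * (S * T) := by noncomm_ring
      _ = B⁻¹ := by rw [hST, hTS, one_mul, mul_one]
  have e' : a • B⁻¹ + (1 - a) • A⁻¹ = T * (a • (T * B * T)⁻¹ + (1 - a) • 1) * T := by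
    rw [Matrix.mul_inv_rev, Matrix.mul_inv_rev, hTi, ← mul_assoc S, mul_add, add_mul,
      mul_smul_comm, smul_mul_assoc, e, mul_smul_comm, smul_mul_assoc, mul_one, hTT]
  rw [e']
  generalize a • (T * B * T)⁻¹ + (1 - a) • 1 = Y
  rw [Matrix.mul_inv_rev, Matrix.mul_inv_rev, hTi, ← mul_assoc]

end Matrices

section Preservation

variable {α β : ℝ} {f : ℝ → ℝ}

lemma preservesMean_powerRep_one (hα : α ∈ Icc (0 : ℝ) 1) (hβ : β ∈ Icc (0 : ℝ) 1)
    (hf : ∀ t, 0 < t → f t = powerRep 1 β t) : PreservesMean (powerRep 1 α) f := by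
  intro n A B hA hB
  have key : ∀ {X : Matrix (Fin n) (Fin n) ℂ}, X.PosDef → matFun f X = β • X + (1 - β) • 1 :=
    fun hX => (matFun_congr hX hf).trans (matFun_powerRep_one hX β)
  rw [kuboMean_powerRep_one hA hB, key hA, key hB, key (hB.combination hA hα),
    kuboMean_powerRep_one (hA.combination .one hβ) (hB.combination .one hβ)]
  module

lemma preservesMean_powerRep_neg_one (hα : α ∈ Icc (0 : ℝ) 1) (hβ : β ∈ Icc (0 : ℝ) 1)
    (hf : ∀ t, 0 < t → f t = powerRep (-1) β t) : PreservesMean (powerRep (-1) α) f := by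
  intro n A B hA hB
  have key : ∀ {X : Matrix (Fin n) (Fin n) ℂ}, X.PosDef →
      matFun f X = (β • X⁻¹ + (1 - β) • 1)⁻¹ :=
    fun hX => (matFun_congr hX hf).trans (matFun_powerRep_neg_one hX hβ)
  have inv_inv' : ∀ {X : Matrix (Fin n) (Fin n) ℂ}, X.PosDef → X⁻¹⁻¹ = X :=
    fun hX => Matrix.nonsing_inv_nonsing_inv _ ((Matrix.isUnit_iff_isUnit_det _).mp hX.isUnit)
  have hA' := hA.inv.combination .one hβ
  have hB' := hB.inv.combination .one hβ
  have hM := hB.inv.combination hA.inv hα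
  rw [kuboMean_powerRep_neg_one hA hB hα, key hA, key hB, key hM.inv,
    kuboMean_powerRep_neg_one hA'.inv hB'.inv hα, inv_inv' hA', inv_inv' hB', inv_inv' hM]
  congr 1
  module

lemma eq_powerRep_one_of_preservesMean (hα : α ∈ Ioo (0 : ℝ) 1) (hf : OMone f)
    (h : PreservesMean (powerRep 1 α) f) :
    ∃ β ∈ Icc (0 : ℝ) 1, ∀ t, 0 < t → f t = powerRep 1 β t := by
  obtain ⟨hpos, hone, hmono⟩ := hf
  simp only [powerRep_one]
  refine eq_affine_of_monotoneOn_of_combination hα hpos hone hmono.monotoneOn fun x y hx hy => ?_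
  have e := h.scalar hx hy
  rwa [scalar_mean_powerRep_one α y hx, scalar_mean_powerRep_one α _ (hpos x hx)] at e

lemma eq_powerRep_neg_one_of_preservesMean (hα : α ∈ Ioo (0 : ℝ) 1) (hf : OMone f)
    (h : PreservesMean (powerRep (-1) α) f) :
    ∃ β ∈ Icc (0 : ℝ) 1, ∀ t, 0 < t → f t = powerRep (-1) β t := by
  obtain ⟨hpos, hone, hmono⟩ := hf
  have hpos' : ∀ t, 0 < t → 0 < f t⁻¹ := fun t ht => hpos _ (inv_pos.mpr ht)
  have hmono' : MonotoneOn (adjFun f) (Ioi 0) := fun x hx y hy hxy =>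
    inv_anti₀ (hpos' y hy) (hmono.monotoneOn (mem_Ioi.mpr (inv_pos.mpr hy))
      (mem_Ioi.mpr (inv_pos.mpr hx)) (inv_anti₀ hx hxy))
  obtain ⟨β, hβ, e⟩ := eq_affine_of_monotoneOn_of_combination (h := adjFun f) hα
    (fun t ht => inv_pos.mpr (hpos' t ht)) (by simp [adjFun, hone]) hmono' fun x y hx hy => by
      have e := h.scalar (inv_pos.mpr hx) (inv_pos.mpr hy)
      rw [scalar_mean_powerRep_neg_one α _ (inv_pos.mpr hx),
        scalar_mean_powerRep_neg_one α _ (hpos' x hx), inv_inv, inv_inv] at e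
      simp only [adjFun]
      rw [e, inv_inv]
  refine ⟨β, hβ, fun t ht => ?_⟩
  rw [powerRep_neg_one, ← e _ (inv_pos.mpr ht), adjFun, inv_inv, inv_inv]

end Preservation

theorem stmt_16 (r α : ℝ) (hr : r = -1 ∨ r = 1) (hα : α ∈ Set.Ioo (0 : ℝ) 1)
    (f : ℝ → ℝ) (hf : OMone f) :
    PreservesMean (powerRep r α) f ↔
      ∃ β ∈ Set.Icc (0 : ℝ) 1, ∀ t : ℝ, 0 < t → f t = powerRep r β t := by
  have hα' : α ∈ Set.Icc (0 : ℝ) 1 := Set.Ioo_subset_Icc_self hα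
  rcases hr with rfl | rfl
  · exact ⟨eq_powerRep_neg_one_of_preservesMean hα hf,
      fun ⟨_, hβ, h⟩ => preservesMean_powerRep_neg_one hα' hβ h⟩
  · exact ⟨eq_powerRep_one_of_preservesMean hα hf,
      fun ⟨_, hβ, h⟩ => preservesMean_powerRep_one hα' hβ h⟩
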